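/- Let G be a bidirected tree with seed set S and boost set B, and assume that every non-seed node is activated with probability strictly less than one (ap_B(w) < 1 for all w ∉ S). Then for every non-seed node u and every neighbor v of u, the gain satisfies g_B(u\v) = (1 − ap_B(u\v)) + ∑_{w ∈ N(u) \ {v}} [(1 − ap_B(u\v)) / (1 − ap_B(w\u) · p^B_{wu})] · p^B_{uw} · g_B(w\u). -/

import Mathlib

open Finset
open scoped Classical

noncomputable section

variable {V : Type*}

/-- The probability weight of the live-edge configuration `L ⊆ E`:
each edge `e ∈ E` is independently live with probability `p e`. -/
def edgeWeight [DecidableEq V] (E : Finset (V × V)) (p : V × V → ℝ)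
    (L : Finset (V × V)) : ℝ :=
  (∏ e ∈ L, p e) * ∏ e ∈ E \ L, (1 - p e)

/-- `v` is activated in configuration `L`: it is reachable from some seed in `S`
through live (directed) edges. -/
def Reaches (L : Finset (V × V)) (S : Finset V) (v : V) : Prop :=
  ∃ s ∈ S, Relation.ReflTransGen (fun a b => (a, b) ∈ L) s v

/-- Activation probability of node `v` under the live-edge model with edge set `E`,
edge probabilities `p`, and seed set `S`. -/
def ap [Fintype V] [DecidableEq V] (E : Finset (V × V)) (p : V × V → ℝ)
    (S : Finset V) (v : V) : ℝ :=
  ∑ L ∈ E.powerset, edgeWeight E p L * (if Reaches L S v then 1 else 0)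

/-- Expected number of activated nodes lying in the node set `W`. -/
def spreadOn [Fintype V] [DecidableEq V] (E : Finset (V × V)) (p : V × V → ℝ)
    (S W : Finset V) : ℝ :=
  ∑ L ∈ E.powerset, edgeWeight E p L * ((W.filter (fun v => Reaches L S v)).card : ℝ)

/-- The influence spread `σ_S`: expected total number of activated nodes. -/
def spread [Fintype V] [DecidableEq V] (E : Finset (V × V)) (p : V × V → ℝ)
    (S : Finset V) : ℝ :=
  spreadOn E p S Finset.univ

/-- Boosted edge probabilities: edges pointing into a boosted node use `p'`. -/
def pB (p p' : V × V → ℝ) (B : Finset V) : V × V → ℝ :=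
  fun e => if e.2 ∈ B then p' e else p e

/-- The bidirected edge set of an undirected graph: each undirected edge is
replaced by the two directed edges. -/
def treeEdges [Fintype V] [DecidableEq V] (T : SimpleGraph V) [DecidableRel T.Adj] :
    Finset (V × V) :=
  Finset.univ.filter (fun e => T.Adj e.1 e.2)

/-- `apSub E p S v u` is `ap_B(v\u)`: the activation probability of `v` in the
subtree `G_{v\u}` obtained by removing the directed edges `(u,v)` and `(v,u)`. -/
def apSub [Fintype V] [DecidableEq V] (E : Finset (V × V)) (p : V × V → ℝ)
    (S : Finset V) (v u : V) : ℝ :=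
  ap (E \ {(u, v), (v, u)}) p S v

/-- The set of nodes of the connected component containing `v` w.r.t. edge set `E`. -/
def comp [Fintype V] [DecidableEq V] (E : Finset (V × V)) (v : V) : Finset V :=
  Finset.univ.filter (fun w => Relation.ReflTransGen (fun a b => (a, b) ∈ E) v w)

/-- `gain E p S v u` is `g_B(v\u)`: in the subtree `G_{v\u}`, the expected number of
activated nodes when the seed set is `(S ∩ V(G_{v\u})) ∪ {v}` minus the expected
number when the seed set is `S ∩ V(G_{v\u})`. -/
def gain [Fintype V] [DecidableEq V] (E : Finset (V × V)) (p : V × V → ℝ)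
    (S : Finset V) (v u : V) : ℝ :=
  spreadOn (E \ {(u, v), (v, u)}) p (insert v (S ∩ comp (E \ {(u, v), (v, u)}) v))
      (comp (E \ {(u, v), (v, u)}) v)
    - spreadOn (E \ {(u, v), (v, u)}) p (S ∩ comp (E \ {(u, v), (v, u)}) v)
      (comp (E \ {(u, v), (v, u)}) v)

/-- Expectation of `f` over the live-edge configurations `L ⊆ E`. -/
def liveExp [DecidableEq V] (E : Finset (V × V)) (p : V × V → ℝ)
    (f : Finset (V × V) → ℝ) : ℝ :=
  ∑ L ∈ E.powerset, edgeWeight E p L * f L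

/-- The indicator that `x` is reached from `u` but not from `S`. -/
def newlyReached (S : Finset V) (u x : V) (L : Finset (V × V)) : ℝ :=
  if Reaches L {u} x ∧ ¬ Reaches L S x then 1 else 0

/-- The edges of `L` with both endpoints in `D`. -/
def inside [DecidableEq V] (D : Finset V) (L : Finset (V × V)) : Finset (V × V) :=
  L.filter (fun e => e.1 ∈ D ∧ e.2 ∈ D)

/-- The edges of `L` with no endpoint in `D`. -/
def outside [DecidableEq V] (D : Finset V) (L : Finset (V × V)) : Finset (V × V) :=
  L.filter (fun e => e.1 ∉ D ∧ e.2 ∉ D)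

/-- Every edge of `L` between `D` and its complement joins `w ∈ D` and `u ∉ D`. -/
def CrossesOnlyAt (L : Finset (V × V)) (D : Finset V) (w u : V) : Prop :=
  ∀ e ∈ L, (e.1 ∈ D → e.2 ∉ D → e = (w, u)) ∧ (e.1 ∉ D → e.2 ∈ D → e = (u, w))

section Probability

variable [DecidableEq V] {E A C : Finset (V × V)} {p : V × V → ℝ}

lemma edgeWeight_union (hAC : Disjoint A C) {K M : Finset (V × V)} (hK : K ⊆ A) (hM : M ⊆ C) :
    edgeWeight (A ∪ C) p (K ∪ M) = edgeWeight A p K * edgeWeight C p M := by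
  have h1 : Disjoint K M := Finset.disjoint_of_subset_left hK (Finset.disjoint_of_subset_right hM hAC)
  have h2 : (A ∪ C) \ (K ∪ M) = (A \ K) ∪ (C \ M) := by
    ext e
    have := @hK e
    have := @hM e
    have : e ∈ A → e ∉ C := fun h => Finset.disjoint_left.mp hAC h
    simp only [mem_sdiff, mem_union]
    tauto
  have h3 : Disjoint (A \ K) (C \ M) :=
    Finset.disjoint_of_subset_left sdiff_subset (Finset.disjoint_of_subset_right sdiff_subset hAC)
  unfold edgeWeight
  rw [h2, Finset.prod_union h1, Finset.prod_union h3]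
  ring

/-- Independence of configurations on disjoint edge sets. -/
lemma liveExp_mul (hE : E = A ∪ C) (hAC : Disjoint A C) {F f g : Finset (V × V) → ℝ}
    (hF : ∀ L ⊆ E, F L = f (L ∩ A) * g (L ∩ C)) :
    liveExp E p F = liveExp A p f * liveExp C p g := by
  subst hE
  unfold liveExp
  rw [Finset.sum_mul_sum, ← Finset.sum_product']
  refine Finset.sum_nbij' (fun L => (L ∩ A, L ∩ C)) (fun K => K.1 ∪ K.2) ?_ ?_ ?_ ?_ ?_
  · intro L _
    simp [Finset.inter_subset_right]
  · intro K hK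
    simp only [mem_product, mem_powerset] at hK ⊢
    exact Finset.union_subset_union hK.1 hK.2
  · intro L hL
    rw [mem_powerset] at hL
    rw [← Finset.inter_union_distrib_left, Finset.inter_eq_left.mpr hL]
  · rintro ⟨K, M⟩ hK
    simp only [mem_product, mem_powerset] at hK
    ext e <;>
    · have := @hK.1 e
      have := @hK.2 e
      have : e ∈ A → e ∉ C := fun h => Finset.disjoint_left.mp hAC h
      simp only [mem_inter, mem_union]
      tauto
  · intro L hL
    rw [mem_powerset] at hL
    have h := edgeWeight_union (p := p) hAC (K := L ∩ A) (M := L ∩ C)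
      Finset.inter_subset_right Finset.inter_subset_right
    rw [← Finset.inter_union_distrib_left, Finset.inter_eq_left.mpr hL] at h
    rw [h, hF L hL]
    ring

lemma liveExp_one : liveExp E p (fun _ => 1) = 1 := by
  have h := Finset.prod_add p (fun e => 1 - p e) E
  simp only [add_sub_cancel, Finset.prod_const_one] at h
  simp only [liveExp, edgeWeight, mul_one]
  exact h.symm

lemma liveExp_sub (f g : Finset (V × V) → ℝ) :
    liveExp E p (fun L => f L - g L) = liveExp E p f - liveExp E p g := by
  simp only [liveExp, mul_sub, Finset.sum_sub_distrib]

lemma liveExp_congr {f g : Finset (V × V) → ℝ} (h : ∀ L ⊆ E, f L = g L) :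
    liveExp E p f = liveExp E p g :=
  Finset.sum_congr rfl fun L hL => by rw [h L (Finset.mem_powerset.mp hL)]

/-- The expectation of a function of `L ∩ A` is computed on the edge set `A`. -/
lemma liveExp_of_subset (hA : A ⊆ E) {F f : Finset (V × V) → ℝ}
    (hF : ∀ L ⊆ E, F L = f (L ∩ A)) : liveExp E p F = liveExp A p f := by
  rw [liveExp_mul (A := A) (C := E \ A) (f := f) (g := fun _ => 1)
    (Finset.union_sdiff_of_subset hA).symm Finset.disjoint_sdiff
    (fun L hL => by rw [hF L hL, mul_one]), liveExp_one, mul_one]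

lemma liveExp_mem {e : V × V} (he : e ∈ E) :
    liveExp E p (fun L => if e ∈ L then 1 else 0) = p e := by
  rw [liveExp_of_subset (A := {e}) (f := fun L => if e ∈ L then 1 else 0) (by simpa using he)
    (fun L _ => by simp)]
  rw [← insert_empty_eq e, liveExp, Finset.sum_powerset_insert (Finset.notMem_empty e)]
  simp [edgeWeight]

lemma liveExp_mono (h0 : ∀ e, 0 ≤ p e) (h1 : ∀ e, p e ≤ 1) {f g : Finset (V × V) → ℝ}
    (h : ∀ L ⊆ E, f L ≤ g L) : liveExp E p f ≤ liveExp E p g := by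
  refine Finset.sum_le_sum fun L hL => mul_le_mul_of_nonneg_left (h L (mem_powerset.mp hL)) ?_
  exact mul_nonneg (Finset.prod_nonneg fun e _ => h0 e)
    (Finset.prod_nonneg fun e _ => sub_nonneg.mpr (h1 e))

lemma one_sub_ap [Fintype V] (S : Finset V) (x : V) :
    1 - ap E p S x = liveExp E p (fun L => if Reaches L S x then 0 else 1) := by
  have h : ap E p S x = liveExp E p (fun L => if Reaches L S x then 1 else 0) := rfl
  rw [h]
  nth_rw 1 [← liveExp_one (E := E) (p := p)]
  rw [← liveExp_sub]
  refine liveExp_congr fun L _ => ?_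
  split_ifs <;> norm_num

end Probability

section Reachability

lemma Reaches.step {L : Finset (V × V)} {S : Finset V} {a b : V} (h : Reaches L S a)
    (hab : (a, b) ∈ L) : Reaches L S b := by
  obtain ⟨s, hs, h⟩ := h
  exact ⟨s, hs, h.tail hab⟩

lemma Reaches.self {L : Finset (V × V)} {S : Finset V} {a : V} (h : a ∈ S) : Reaches L S a :=
  ⟨a, h, .refl⟩

lemma Reaches.mono {L M : Finset (V × V)} (hLM : L ⊆ M) {S : Finset V} {a : V}
    (h : Reaches L S a) : Reaches M S a := by
  obtain ⟨s, hs, h⟩ := h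
  exact ⟨s, hs, Relation.ReflTransGen.mono (fun _ _ hab => hLM hab) _ _ h⟩

lemma Reaches.trans {L : Finset (V × V)} {S : Finset V} {a b : V} (h : Reaches L S a)
    (hab : Reaches L {a} b) : Reaches L S b := by
  obtain ⟨s, hs, h⟩ := h
  obtain ⟨t, ht, h'⟩ := hab
  rw [Finset.mem_singleton] at ht
  subst ht
  exact ⟨s, hs, h.trans h'⟩

lemma Reaches.induction {L : Finset (V × V)} {S : Finset V} {P : V → Prop}
    (hS : ∀ s ∈ S, P s) (hstep : ∀ a b, P a → (a, b) ∈ L → P b) {x : V}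
    (h : Reaches L S x) : P x := by
  obtain ⟨s, hs, h⟩ := h
  induction h with
  | refl => exact hS s hs
  | tail _ hbc ih => exact hstep _ _ ih hbc

lemma Reaches.symm {E : Finset (V × V)}
    (hE : ∀ a b, (a, b) ∈ E → (b, a) ∈ E) {a b : V} (h : Reaches E {a} b) :
    Reaches E {b} a := by
  refine h.induction (P := fun y => Reaches E {y} a) ?_ fun x y hx hxy => ?_
  · rintro s hs
    rw [Finset.mem_singleton] at hs
    exact .self (by simp [hs])
  · exact Reaches.trans ((Reaches.self (by simp)).step (hE _ _ hxy)) hx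

lemma CrossesOnlyAt.mono {L M : Finset (V × V)} {D : Finset V} {u w : V}
    (h : CrossesOnlyAt M D w u) (hLM : L ⊆ M) :
    CrossesOnlyAt L D w u := fun e he => h e (hLM he)

lemma reaches_insert [DecidableEq V] {L : Finset (V × V)} {S : Finset V} {a x : V} :
    Reaches L (insert a S) x ↔ Reaches L {a} x ∨ Reaches L S x := by
  simp [Reaches]

variable [DecidableEq V] {L : Finset (V × V)} {D S : Finset V} {u w x : V}

lemma mem_inside {a b : V} : (a, b) ∈ inside D L ↔ (a, b) ∈ L ∧ a ∈ D ∧ b ∈ D := by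
  simp [inside]

lemma mem_outside {a b : V} : (a, b) ∈ outside D L ↔ (a, b) ∈ L ∧ a ∉ D ∧ b ∉ D := by
  simp [outside]

lemma CrossesOnlyAt.reaches (h : CrossesOnlyAt L D w u) (hx : Reaches L S x) :
    (x ∈ D ∧ (Reaches (inside D L) S x ∨
      ((u, w) ∈ L ∧ Reaches (inside D L) {w} x ∧ Reaches (outside D L) S u))) ∨
    (x ∉ D ∧ (Reaches (outside D L) S x ∨
      ((w, u) ∈ L ∧ Reaches (outside D L) {u} x ∧ Reaches (inside D L) S w))) := by
  refine hx.induction (P := fun y =>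
    (y ∈ D ∧ (Reaches (inside D L) S y ∨
      ((u, w) ∈ L ∧ Reaches (inside D L) {w} y ∧ Reaches (outside D L) S u))) ∨
    (y ∉ D ∧ (Reaches (outside D L) S y ∨
      ((w, u) ∈ L ∧ Reaches (outside D L) {u} y ∧ Reaches (inside D L) S w))))
    (fun s hs => ?_) (fun a b hab hL => ?_)
  · by_cases hD : s ∈ D
    · exact .inl ⟨hD, .inl (.self hs)⟩
    · exact .inr ⟨hD, .inl (.self hs)⟩
  · rcases hab with ⟨ha, hab⟩ | ⟨ha, hab⟩
    · by_cases hb : b ∈ D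
      · have hi := mem_inside.mpr ⟨hL, ha, hb⟩
        rcases hab with hab | ⟨h1, h2, h3⟩
        · exact .inl ⟨hb, .inl (hab.step hi)⟩
        · exact .inl ⟨hb, .inr ⟨h1, h2.step hi, h3⟩⟩
      · obtain ⟨rfl, rfl⟩ := Prod.mk.inj ((h _ hL).1 ha hb)
        rcases hab with hab | ⟨h1, h2, h3⟩
        · exact .inr ⟨hb, .inr ⟨hL, .self (by simp), hab⟩⟩
        · exact .inr ⟨hb, .inl h3⟩
    · by_cases hb : b ∈ D
      · obtain ⟨rfl, rfl⟩ := Prod.mk.inj ((h _ hL).2 ha hb)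
        rcases hab with hab | ⟨h1, h2, h3⟩
        · exact .inl ⟨hb, .inr ⟨hL, .self (by simp), hab⟩⟩
        · exact .inl ⟨hb, .inl h3⟩
      · have ho := mem_outside.mpr ⟨hL, ha, hb⟩
        rcases hab with hab | ⟨h1, h2, h3⟩
        · exact .inr ⟨hb, .inl (hab.step ho)⟩
        · exact .inr ⟨hb, .inr ⟨h1, h2.step ho, h3⟩⟩

lemma CrossesOnlyAt.reaches_mem_iff (h : CrossesOnlyAt L D w u) (hx : x ∈ D) :
    Reaches L S x ↔ Reaches (inside D L) S x ∨
      ((u, w) ∈ L ∧ Reaches (inside D L) {w} x ∧ Reaches (outside D L) S u) := by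
  constructor
  · intro hr
    rcases h.reaches hr with h | h
    · exact h.2
    · exact absurd hx h.1
  · rintro (hr | ⟨h1, h2, h3⟩)
    · exact hr.mono (filter_subset _ _)
    · exact ((h3.mono (filter_subset _ _)).step h1).trans (h2.mono (filter_subset _ _))

lemma CrossesOnlyAt.reaches_notMem_iff (h : CrossesOnlyAt L D w u) (hu : u ∉ D) :
    Reaches L S u ↔ Reaches (outside D L) S u ∨ ((w, u) ∈ L ∧ Reaches (inside D L) S w) := by
  constructor
  · intro hr
    rcases h.reaches hr with h | h
    · exact absurd h.1 hu
    · exact h.2.imp id fun h => ⟨h.1, h.2.2⟩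
  · rintro (hr | ⟨h1, h2⟩)
    · exact hr.mono (filter_subset _ _)
    · exact (h2.mono (filter_subset _ _)).step h1

lemma not_reaches_inside (hu : u ∉ D) (hx : x ∈ D) : ¬ Reaches (inside D L) {u} x := by
  intro h
  have : x = u := h.induction (P := fun y => y = u) (by simp) fun a b ha hab =>
    absurd (ha ▸ (mem_inside.mp hab).2.1) hu
  exact hu (this ▸ hx)

lemma CrossesOnlyAt.newlyReached_eq (h : CrossesOnlyAt L D w u) (hu : u ∉ D) (hx : x ∈ D) :
    newlyReached S u x L = newlyReached S w x (inside D L) *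
      ((if (u, w) ∈ L then 1 else 0) * (if Reaches (outside D L) S u then 0 else 1)) := by
  have h1 := h.reaches_mem_iff (S := S) hx
  have h2 := h.reaches_mem_iff (S := {u}) hx
  have h3 := not_reaches_inside (L := L) hu hx
  have h4 : Reaches (outside D L) {u} u := .self (by simp)
  unfold newlyReached
  by_cases c1 : (u, w) ∈ L <;> by_cases c2 : Reaches (inside D L) {w} x <;>
    by_cases c3 : Reaches (inside D L) S x <;> by_cases c4 : Reaches (outside D L) S u <;>
    simp [h1, h2, h3, h4, c1, c2, c3, c4]

lemma inside_of_subset {E : Finset (V × V)} (hL : L ⊆ E) : inside D L = L ∩ inside D E := by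
  ext ⟨a, b⟩
  have := @hL (a, b)
  simp only [mem_inside, mem_inter]
  tauto

lemma outside_of_subset {E : Finset (V × V)} (hL : L ⊆ E) : outside D L = L ∩ outside D E := by
  ext ⟨a, b⟩
  have := @hL (a, b)
  simp only [mem_outside, mem_inter]
  tauto

end Reachability

section Cut

variable [DecidableEq V] {E : Finset (V × V)} {p : V × V → ℝ} {D S : Finset V}
  {u w : V}

lemma CrossesOnlyAt.eq_union (h : CrossesOnlyAt E D w u) (huw : (u, w) ∈ E) (hwu : (w, u) ∈ E) :
    E = inside D E ∪ ({(u, w), (w, u)} ∪ outside D E) := by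
  ext ⟨a, b⟩
  have h1 := h (a, b)
  simp only [mem_union, mem_inside, mem_outside, mem_insert, mem_singleton]
  constructor
  · intro hab
    have := h1 hab
    simp only at this
    tauto
  · rintro (h | (h | h) | h)
    · exact h.1
    · exact h ▸ huw
    · exact h ▸ hwu
    · exact h.1

lemma disjoint_inside (hw : w ∈ D) (hu : u ∉ D) :
    Disjoint (inside D E) ({(u, w), (w, u)} ∪ outside D E) := by
  rw [Finset.disjoint_left]
  rintro ⟨a, b⟩ h1 h2
  simp only [mem_union, mem_inside, mem_outside, mem_insert, mem_singleton, Prod.mk.injEq] at h1 h2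
  rcases h2 with (⟨rfl, rfl⟩ | ⟨rfl, rfl⟩) | h2 <;> tauto

lemma disjoint_outside (hw : w ∈ D) :
    Disjoint {(u, w), (w, u)} (outside D E) := by
  rw [Finset.disjoint_left]
  rintro ⟨a, b⟩ h1 h2
  simp only [mem_outside, mem_insert, mem_singleton, Prod.mk.injEq] at h1 h2
  rcases h1 with ⟨rfl, rfl⟩ | ⟨rfl, rfl⟩ <;> tauto

/-- Expected new activation across the cut: it factors into the part inside `D`, the edge
`(u, w)`, and the part outside `D`. -/
lemma CrossesOnlyAt.liveExp_newlyReached [Fintype V] (h : CrossesOnlyAt E D w u) (hw : w ∈ D) (hu : u ∉ D)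
    (huw : (u, w) ∈ E) (hwu : (w, u) ∈ E) {x : V} (hx : x ∈ D) :
    liveExp E p (newlyReached S u x) = liveExp (inside D E) p (newlyReached S w x) *
      (p (u, w) * (1 - ap (outside D E) p S u)) := by
  have h1 := liveExp_mem (p := p) (E := {(u, w), (w, u)}) (e := (u, w)) (by simp)
  rw [one_sub_ap, ← h1]
  rw [← liveExp_mul (E := {(u, w), (w, u)} ∪ outside D E) rfl (disjoint_outside hw)
    (fun L _ => rfl)]
  refine liveExp_mul (h.eq_union huw hwu) (disjoint_inside hw hu) fun L hL => ?_
  rw [(h.mono hL).newlyReached_eq hu hx, inside_of_subset hL, outside_of_subset hL]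
  have h2 : L ∩ ({(u, w), (w, u)} ∪ outside D E) ∩ outside D E = L ∩ outside D E := by
    rw [Finset.inter_assoc, Finset.union_inter_cancel_right]
  have h3 : (u, w) ∈ L ∩ ({(u, w), (w, u)} ∪ outside D E) ∩ {(u, w), (w, u)} ↔ (u, w) ∈ L := by
    simp
  simp only [h2, h3]

/-- The probability that `u` is not activated factors across the cut. -/
lemma CrossesOnlyAt.one_sub_ap_eq [Fintype V] (h : CrossesOnlyAt E D w u) (hw : w ∈ D) (hu : u ∉ D)
    (huw : (u, w) ∈ E) (hwu : (w, u) ∈ E) :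
    1 - ap E p S u = (1 - ap (inside D E) p S w * p (w, u)) * (1 - ap (outside D E) p S u) := by
  have h1 := liveExp_mem (p := p) (E := {(u, w), (w, u)}) (e := (w, u)) (by simp)
  have hd := disjoint_inside (E := E) hw hu
  rw [Finset.disjoint_union_right] at hd
  have h2 : ap (inside D E) p S w =
    liveExp (inside D E) p (fun L => if Reaches L S w then 1 else 0) := rfl
  rw [one_sub_ap, one_sub_ap, h2, ← h1]
  rw [← liveExp_mul (E := inside D E ∪ {(u, w), (w, u)}) rfl hd.1 (fun L _ => rfl)]
  nth_rw 2 [← liveExp_one (E := inside D E ∪ {(u, w), (w, u)}) (p := p)]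
  rw [← liveExp_sub]
  have hE := h.eq_union huw hwu
  rw [← Finset.union_assoc] at hE
  refine liveExp_mul hE (Finset.disjoint_union_left.mpr ⟨hd.2, disjoint_outside hw⟩) fun L hL => ?_
  have h3 := (h.mono hL).reaches_notMem_iff (S := S) hu
  rw [inside_of_subset hL, outside_of_subset hL] at h3
  have h4 : L ∩ (inside D E ∪ {(u, w), (w, u)}) ∩ inside D E = L ∩ inside D E := by
    rw [Finset.inter_assoc, Finset.union_inter_cancel_left]
  have h5 : (w, u) ∈ L ∩ (inside D E ∪ {(u, w), (w, u)}) ∩ {(u, w), (w, u)} ↔ (w, u) ∈ L := by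
    simp
  simp only [h3, h4, h5]
  by_cases c1 : (w, u) ∈ L <;> by_cases c2 : Reaches (L ∩ inside D E) S w <;>
    by_cases c3 : Reaches (L ∩ outside D E) S u <;> simp [c1, c2, c3]

lemma CrossesOnlyAt.ap_eq_inside [Fintype V] (h : CrossesOnlyAt E D w u) (hw : w ∈ D) (huw : (u, w) ∉ E) :
    ap E p S w = ap (inside D E) p S w := by
  refine liveExp_of_subset (A := inside D E) (filter_subset _ _) fun L hL => ?_
  have h1 := (h.mono hL).reaches_mem_iff (S := S) hw
  have h2 : (u, w) ∉ L := fun h => huw (hL h)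
  simp [h1, h2, inside_of_subset hL]

lemma CrossesOnlyAt.newlyReached_eq_inside (h : CrossesOnlyAt E D w u) (huw : (u, w) ∉ E)
    {x : V} (hx : x ∈ D) :
    liveExp E p (newlyReached S w x) = liveExp (inside D E) p (newlyReached S w x) := by
  refine liveExp_of_subset (A := inside D E) (filter_subset _ _) fun L hL => ?_
  have h1 := (h.mono hL).reaches_mem_iff (S := S) hx
  have h3 := (h.mono hL).reaches_mem_iff (S := {w}) hx
  have h2 : (u, w) ∉ L := fun h => huw (hL h)
  simp [newlyReached, h1, h2, h3, inside_of_subset hL]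

end Cut

section Component

variable [Fintype V] [DecidableEq V] {E : Finset (V × V)} {p : V × V → ℝ} {S : Finset V}
  {u v w : V}

lemma mem_comp {x : V} : x ∈ comp E u ↔ Reaches E {u} x := by
  simp [comp, Reaches]

/-- The gain of `u` is the expected number of nodes reached from `u` but not from `S`. -/
lemma gain_eq (hE : ∀ a b, (a, b) ∈ E → (b, a) ∈ E) :
    gain E p S u v = ∑ x ∈ comp (E \ {(v, u), (u, v)}) u,
      liveExp (E \ {(v, u), (u, v)}) p (newlyReached S u x) := by
  unfold gain spreadOn
  have hsymm : ∀ a b, (a, b) ∈ E \ {(v, u), (u, v)} → (b, a) ∈ E \ {(v, u), (u, v)} := by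
    intro a b
    have := hE a b
    simp only [mem_sdiff, mem_insert, mem_singleton, Prod.mk.injEq]
    tauto
  generalize E \ {(v, u), (u, v)} = F at *
  unfold liveExp
  rw [Finset.sum_comm, ← Finset.sum_sub_distrib]
  refine Finset.sum_congr rfl fun L hL => ?_
  rw [mem_powerset] at hL
  rw [← mul_sub, ← Finset.mul_sum, Finset.card_filter, Finset.card_filter]
  push_cast
  rw [← Finset.sum_sub_distrib]
  congr 1
  refine Finset.sum_congr rfl fun x hx => ?_
  have h : Reaches L (S ∩ comp F u) x ↔ Reaches L S x := by
    constructor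
    · rintro ⟨s, hs, h⟩
      exact ⟨s, (mem_inter.mp hs).1, h⟩
    · rintro ⟨s, hs, h⟩
      refine ⟨s, mem_inter.mpr ⟨hs, mem_comp.mpr ((mem_comp.mp hx).trans ?_)⟩, h⟩
      exact Reaches.symm hsymm (Reaches.mono hL ⟨s, by simp, h⟩)
  simp only [reaches_insert, h, newlyReached]
  by_cases c1 : Reaches L {u} x <;> by_cases c2 : Reaches L S x <;> simp [c1, c2]

lemma crossesOnlyAt_comp (hE : ∀ a b, (a, b) ∈ E → (b, a) ∈ E)
    (hu : u ∉ comp (E \ {(u, w), (w, u)}) w) :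
    CrossesOnlyAt E (comp (E \ {(u, w), (w, u)}) w) w u := by
  have key : ∀ a b, (a, b) ∈ E → a ∈ comp (E \ {(u, w), (w, u)}) w →
      b ∉ comp (E \ {(u, w), (w, u)}) w → (a, b) = (w, u) := by
    intro a b hab ha hb
    by_contra hne
    rw [mem_comp] at ha hb
    by_cases h : (a, b) = (u, w)
    · rw [(Prod.mk.inj h).1] at ha
      exact hu (mem_comp.mpr ha)
    · exact hb (ha.step (by simp [hab, hne, h, -Prod.mk.injEq]))
  rintro ⟨a, b⟩ hab
  refine ⟨key a b hab, fun ha hb => ?_⟩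
  obtain ⟨rfl, rfl⟩ := Prod.mk.inj (key b a (hE _ _ hab) hb ha)
  rfl

/-- Distinct neighbours of `u` whose edges to `u` are bridges lie in disjoint components. -/
lemma disjoint_comp (hE : ∀ a b, (a, b) ∈ E → (b, a) ∈ E)
    (hbr : ∀ w, (u, w) ∈ E → u ∉ comp (E \ {(u, w), (w, u)}) w) {w' : V}
    (hw : (u, w) ∈ E) (hw' : (u, w') ∈ E) (hne : w ≠ w') :
    Disjoint (comp (E \ {(u, w), (w, u)}) w) (comp (E \ {(u, w'), (w', u)}) w') := by
  rw [Finset.disjoint_left]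
  intro x hx hx'
  have hc := crossesOnlyAt_comp hE (hbr w hw)
  have huw := hbr w hw
  rw [mem_comp] at hx'
  have hsub : ∀ a b, (a, b) ∈ E \ {(u, w'), (w', u)} → (a, b) ∈ E := by
    intro a b h
    exact (mem_sdiff.mp h).1
  have hw'D : w' ∉ comp (E \ {(u, w), (w, u)}) w := by
    intro h
    have := (hc _ (hE _ _ hw')).1 h huw
    exact hne (Prod.mk.inj this).1.symm
  have : x ∉ comp (E \ {(u, w), (w, u)}) w ∧ Reaches (E \ {(u, w'), (w', u)}) {w'} x := by
    refine hx'.induction (P := fun y => y ∉ comp (E \ {(u, w), (w, u)}) w ∧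
      Reaches (E \ {(u, w'), (w', u)}) {w'} y) (fun s hs => ?_) fun a b ha hab => ?_
    · rw [Finset.mem_singleton] at hs
      subst hs
      exact ⟨hw'D, .self (by simp)⟩
    · refine ⟨fun hb => ?_, ha.2.step hab⟩
      have := (hc _ (hsub _ _ hab)).2 ha.1 hb
      rw [(Prod.mk.inj this).1] at ha
      exact hbr w' hw' (mem_comp.mpr ha.2)
  exact this.1 hx

end Component

lemma mem_treeEdges [Fintype V] [DecidableEq V] {T : SimpleGraph V} [DecidableRel T.Adj] {a b : V} :
    (a, b) ∈ treeEdges T ↔ T.Adj a b := by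
  simp [treeEdges]

lemma notMem_comp_treeEdges [Fintype V] [DecidableEq V] {T : SimpleGraph V} [DecidableRel T.Adj]
    (hT : T.IsAcyclic) {u w : V} (h : T.Adj u w) :
    u ∉ comp (treeEdges T \ {(u, w), (w, u)}) w := by
  have hb := SimpleGraph.isAcyclic_iff_forall_adj_isBridge.mp hT h
  rw [SimpleGraph.isBridge_iff] at hb
  intro hu
  rw [mem_comp] at hu
  refine hb (SimpleGraph.Reachable.symm ?_)
  refine hu.induction (P := fun y => (T \ SimpleGraph.fromEdgeSet {s(u, w)}).Reachable w y)
    ?_ fun a b ha hab => ha.trans (SimpleGraph.Adj.reachable ?_)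
  · simp
  · simp only [mem_sdiff, mem_treeEdges, mem_insert, mem_singleton, Prod.mk.injEq, not_or] at hab
    simp only [SimpleGraph.sdiff_adj, SimpleGraph.fromEdgeSet_adj, Set.mem_singleton_iff,
      Sym2.eq_iff]
    tauto

/-- On a bidirected tree where every non-seed node is activated with probability
strictly less than one, for every non-seed node `u` and neighbor `v`, the gain
satisfies the recursion
`g_B(u\v) = (1 − ap_B(u\v)) + ∑_{w ∈ N(u)\{v}}
  [(1 − ap_B(u\v)) / (1 − ap_B(w\u)·p^B_{wu})] · p^B_{uw} · g_B(w\u)`. -/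
theorem gain_recursion [Fintype V] [DecidableEq V]
    (T : SimpleGraph V) [DecidableRel T.Adj] (hT : T.IsTree)
    (p p' : V × V → ℝ)
    (hp0 : ∀ e, 0 ≤ p e) (hpp' : ∀ e, p e ≤ p' e) (hp'1 : ∀ e, p' e ≤ 1)
    (S B : Finset V)
    (hlt : ∀ x, x ∉ S → ap (treeEdges T) (pB p p' B) S x < 1)
    (u : V) (hu : u ∉ S) (v : V) (hv : T.Adj u v) :
    gain (treeEdges T) (pB p p' B) S u v =
      (1 - apSub (treeEdges T) (pB p p' B) S u v)
        + ∑ w ∈ (T.neighborFinset u).erase v,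
            ((1 - apSub (treeEdges T) (pB p p' B) S u v) /
                (1 - apSub (treeEdges T) (pB p p' B) S w u * pB p p' B (w, u)))
              * pB p p' B (u, w) * gain (treeEdges T) (pB p p' B) S w u := by
  set q := pB p p' B with hq
  have hq0 : ∀ e, 0 ≤ q e := fun e => by
    simp only [hq, pB]
    split_ifs
    exacts [(hp0 e).trans (hpp' e), hp0 e]
  have hq1 : ∀ e, q e ≤ 1 := fun e => by
    simp only [hq, pB]
    split_ifs
    exacts [hp'1 e, (hpp' e).trans (hp'1 e)]
  have hsymm : ∀ a b, (a, b) ∈ treeEdges T → (b, a) ∈ treeEdges T := fun a b h =>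
    mem_treeEdges.mpr (mem_treeEdges.mp h).symm
  have hbr : ∀ w, (u, w) ∈ treeEdges T → u ∉ comp (treeEdges T \ {(u, w), (w, u)}) w :=
    fun w hw => notMem_comp_treeEdges hT.isAcyclic (mem_treeEdges.mp hw)
  have hN : ∀ w, w ∈ (T.neighborFinset u).erase v ↔ w ≠ v ∧ (u, w) ∈ treeEdges T := by
    simp [mem_treeEdges]
  have hlt' : 0 < 1 - apSub (treeEdges T) q S u v := by
    have : apSub (treeEdges T) q S u v ≤ ap (treeEdges T) q S u := by
      have h1 : apSub (treeEdges T) q S u v = liveExp (treeEdges T) q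
          (fun L => if Reaches (L ∩ (treeEdges T \ {(v, u), (u, v)})) S u then 1 else 0) :=
        (liveExp_of_subset sdiff_subset fun L _ => rfl).symm
      rw [h1]
      refine liveExp_mono hq0 hq1 fun L _ => ?_
      split_ifs with h1 h2
      · exact le_rfl
      · exact absurd (h1.mono inter_subset_left) h2
      · exact zero_le_one
      · exact le_rfl
    linarith [hlt u hu]
  rw [gain_eq hsymm]
  unfold apSub at hlt' ⊢
  generalize hE : treeEdges T = E at *
  set E' := E \ {(v, u), (u, v)} with hE'
  have hE'E : E' ⊆ E := sdiff_subset
  have hwE' : ∀ w, w ≠ v → (u, w) ∈ E → (u, w) ∈ E' ∧ (w, u) ∈ E' := by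
    intro w hwv hw
    have huw : u ≠ w := by
      rintro rfl
      exact hbr u hw (mem_comp.mpr (.self (by simp)))
    have huv : u ≠ v := by
      rintro rfl
      exact hv.ne rfl
    have := hsymm _ _ hw
    simp [hE', hw, this, hwv, huv, huw.symm]
  have hD : ∀ w, (u, w) ∈ E → w ∈ comp (E \ {(u, w), (w, u)}) w := fun w _ =>
    mem_comp.mpr (.self (by simp))
  have hreach : ∀ x, Reaches E' {u} x →
      x ∈ insert u (((T.neighborFinset u).erase v).biUnion
        fun w => comp (E \ {(u, w), (w, u)}) w) := by
    intro x hx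
    refine hx.induction (fun s hs => ?_) fun a b ha hab => ?_
    · simp_all
    · simp only [Finset.mem_insert, Finset.mem_biUnion] at ha ⊢
      by_cases hbu : b = u
      · exact .inl hbu
      refine .inr ?_
      rcases ha with rfl | ⟨w, hw, haw⟩
      · have hbv : b ≠ v := by
          rintro rfl
          simp [hE'] at hab
        exact ⟨b, (hN b).mpr ⟨hbv, hE'E hab⟩, hD b (hE'E hab)⟩
      · refine ⟨w, hw, ?_⟩
        by_contra hb
        have := (crossesOnlyAt_comp hsymm (hbr w ((hN w).mp hw).2) _ (hE'E hab)).1 haw hb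
        exact hbu (Prod.mk.inj this).2
  have hzero : ∀ x, ¬ Reaches E' {u} x → liveExp E' q (newlyReached S u x) = 0 := by
    intro x hx
    refine Finset.sum_eq_zero fun L hL => ?_
    have : ¬ Reaches L {u} x := fun h => hx (h.mono (mem_powerset.mp hL))
    simp [newlyReached, this]
  have hsum : ∑ x ∈ comp E' u, liveExp E' q (newlyReached S u x) =
      ∑ x ∈ insert u (((T.neighborFinset u).erase v).biUnion
        fun w => comp (E \ {(u, w), (w, u)}) w), liveExp E' q (newlyReached S u x) :=
    Finset.sum_subset (fun x hx => hreach x (mem_comp.mp hx))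
      fun x _ hx => hzero x fun h => hx (mem_comp.mpr h)
  rw [hsum, Finset.sum_insert, Finset.sum_biUnion]
  · congr 1
    · rw [one_sub_ap]
      refine liveExp_congr fun L _ => ?_
      have : Reaches L {u} u := .self (by simp)
      by_cases h : Reaches L S u <;> simp [newlyReached, this, h]
    · refine Finset.sum_congr rfl fun w hw => ?_
      obtain ⟨hwv, hwE⟩ := (hN w).mp hw
      obtain ⟨h1, h2⟩ := hwE' w hwv hwE
      have huD := hbr w hwE
      have hwD := hD w hwE
      have hc := crossesOnlyAt_comp hsymm huD
      rw [gain_eq hsymm]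
      set F := E \ {(u, w), (w, u)} with hF
      set D := comp F w with hDdef
      have hin : inside D E' = inside D F := by
        ext ⟨a, b⟩
        simp only [mem_inside, hE', hF, mem_sdiff, mem_insert, mem_singleton, Prod.mk.injEq]
        constructor <;> rintro ⟨⟨h, -⟩, ha, hb⟩ <;> refine ⟨⟨h, ?_⟩, ha, hb⟩ <;>
          rintro (⟨rfl, rfl⟩ | ⟨rfl, rfl⟩) <;> contradiction
      have huwF : (u, w) ∉ F := by simp [hF]
      have hcF : CrossesOnlyAt F D w u := hc.mono sdiff_subset
      have hcE : CrossesOnlyAt E' D w u := hc.mono hE'E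
      have hfac := hcE.one_sub_ap_eq (p := q) (S := S) hwD huD h1 h2
      rw [hin, ← hcF.ap_eq_inside hwD huwF] at hfac
      have hne : 1 - ap F q S w * q (w, u) ≠ 0 := by
        intro h0
        rw [h0, zero_mul] at hfac
        exact hlt'.ne' hfac
      rw [hfac, mul_div_cancel_left₀ _ hne, Finset.mul_sum]
      refine Finset.sum_congr rfl fun x hx => ?_
      rw [hcE.liveExp_newlyReached hwD huD h1 h2 hx, hin, ← hcF.newlyReached_eq_inside huwF hx]
      ring
  · intro w hw w' hw' hne
    exact disjoint_comp hsymm hbr ((hN w).mp hw).2 ((hN w').mp hw').2 hne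
  · simp only [Finset.mem_biUnion, not_exists, not_and]
    exact fun w hw => hbr w ((hN w).mp hw).2

end
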